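/- In the rounding process with LP-feasible x, for every time t and all bins i ≠ j, the indicators of the events V_{i,t} and V_{j,t} satisfy Cov(1_{V_{i,t}}, 1_{V_{j,t}}) ≤ 12c. -/

import Mathlib

open Finset

noncomputable section
open scoped Classical

namespace Rounding

/-- A configuration of all the randomness used by the rounding process: arrival
indicators `A_t`, first picks `I¹_t`, second picks `I²_t`, and acceptance coins
`Y_{i,t}`. -/
abbrev Cfg (m n : ℕ) :=
  (Fin n → Bool) × (Fin n → Fin m) × (Fin n → Fin m) × (Fin m → Fin n → Bool)

/-- The constant `c = 1/100`. -/
def c : ℝ := 1 / 100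

variable (m n : ℕ)

/-- `S x i t = ∑_{t' < t} x i t'`. -/
def S (x : Fin m → Fin n → ℝ) (i : Fin m) (t : Fin n) : ℝ :=
  ∑ t' ∈ Finset.univ.filter fun t' : Fin n => t' < t, x i t'

/-- LP-feasibility of `x` (with arrival probabilities `p t ∈ (0,1]`, every
constraint `∑_i x i t = p t` tight). -/
def LPFeasible (p : Fin n → ℝ) (x : Fin m → Fin n → ℝ) : Prop :=
  (∀ t, 0 < p t ∧ p t ≤ 1) ∧
  (∀ i t, 0 ≤ x i t) ∧
  (∀ i, ∑ t, x i t ≤ 1) ∧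
  (∀ t, ∑ i, x i t = p t) ∧
  (∀ i t, x i t ≤ p t * (1 - S m n x i t))

/-- Edge `(i,t)` is early if `∑_{t' < t} x i t' ≤ (1/2 − c)/(1/2 + c)`. -/
def Early (x : Fin m → Fin n → ℝ) (i : Fin m) (t : Fin n) : Prop :=
  S m n x i t ≤ (1/2 - c) / (1/2 + c)

/-- Edge `(i,t)` is late if it is not early. -/
def Late (x : Fin m → Fin n → ℝ) (i : Fin m) (t : Fin n) : Prop :=
  ¬ Early m n x i t

/-- The acceptance probability `q_{i,t}`. -/
def q (x : Fin m → Fin n → ℝ) (i : Fin m) (t : Fin n) : ℝ :=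
  min 1 ((1/2 + c) / (1 - (1/2 + c) * S m n x i t))

/-- The probability of a configuration: the product of the probabilities of all
the mutually independent components (`P(A_t = 1) = p_t`,
`P(I¹_t = i) = P(I²_t = i) = x_{i,t}/p_t`, `P(Y_{i,t} = 1) = q_{i,t}`). -/
def weight (p : Fin n → ℝ) (x : Fin m → Fin n → ℝ) (cfg : Cfg m n) : ℝ :=
  (∏ t, if cfg.1 t then p t else 1 - p t) *
  (∏ t, x (cfg.2.1 t) t / p t) *
  (∏ t, x (cfg.2.2.1 t) t / p t) *
  ∏ i, ∏ t, if cfg.2.2.2 i t then q m n x i t else 1 - q m n x i t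

/-- Probability of an event. -/
def Pr (p : Fin n → ℝ) (x : Fin m → Fin n → ℝ) (E : Set (Cfg m n)) : ℝ :=
  ∑ cfg : Cfg m n, if cfg ∈ E then weight m n p x cfg else 0

/-- Conditional probability of `E` given `F`. -/
def condPr (p : Fin n → ℝ) (x : Fin m → Fin n → ℝ) (E F : Set (Cfg m n)) : ℝ :=
  Pr m n p x (E ∩ F) / Pr m n p x F

/-- Bin `i` is unmatched in the partial matching `M`. -/
def FreeBin (M : Finset (Fin m × Fin n)) (i : Fin m) : Prop :=
  ∀ t, (i, t) ∉ M

/-- `proc x cfg t = (M₁, M₂)`: the two parts of the matching built by the rounding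
process after processing all times `< t`.  At each time `t`, if ball `t` arrives,
its first pick `I¹_t` is unmatched, and the coin `Y_{I¹_t,t}` comes up heads, then
`(I¹_t, t)` is added to `M₁`; otherwise, if ball `t` arrives, its second pick
`I²_t` is unmatched, and edge `(I²_t, t)` is late, then `(I²_t, t)` is added
to `M₂`. -/
def proc (x : Fin m → Fin n → ℝ) (cfg : Cfg m n) :
    ℕ → Finset (Fin m × Fin n) × Finset (Fin m × Fin n)
  | 0 => (∅, ∅)
  | (t + 1) =>
    let P := proc x cfg t
    if h : t < n then
      let T : Fin n := ⟨t, h⟩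
      let M := P.1 ∪ P.2
      if cfg.1 T = true ∧ FreeBin m n M (cfg.2.1 T) ∧ cfg.2.2.2 (cfg.2.1 T) T = true then
        (insert (cfg.2.1 T, T) P.1, P.2)
      else if cfg.1 T = true ∧ FreeBin m n M (cfg.2.2.1 T) ∧ Late m n x (cfg.2.2.1 T) T then
        (P.1, insert (cfg.2.2.1 T, T) P.2)
      else P
    else P

/-- The final matching `M₁` (edges matched on a first pick). -/
def M1F (x : Fin m → Fin n → ℝ) (cfg : Cfg m n) : Finset (Fin m × Fin n) :=
  (proc m n x cfg n).1

/-- The final matching `M₂` (edges matched on a second pick). -/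
def M2F (x : Fin m → Fin n → ℝ) (cfg : Cfg m n) : Finset (Fin m × Fin n) :=
  (proc m n x cfg n).2

/-- The final matching `M = M₁ ∪ M₂`. -/
def MF (x : Fin m → Fin n → ℝ) (cfg : Cfg m n) : Finset (Fin m × Fin n) :=
  M1F m n x cfg ∪ M2F m n x cfg

/-- `V_{i,t}`: the event that bin `i` is unmatched before time `t`. -/
def V (x : Fin m → Fin n → ℝ) (i : Fin m) (t : Fin n) : Set (Cfg m n) :=
  {cfg | FreeBin m n ((proc m n x cfg t.1).1 ∪ (proc m n x cfg t.1).2) i}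

/-- `O_{i,t}`: the event that bin `i` is matched before time `t`. -/
def O (x : Fin m → Fin n → ℝ) (i : Fin m) (t : Fin n) : Set (Cfg m n) :=
  (V m n x i t)ᶜ

/-- `O^E_{i,t}`: the event that bin `i` is matched along an early edge before time `t`. -/
def OE (x : Fin m → Fin n → ℝ) (i : Fin m) (t : Fin n) : Set (Cfg m n) :=
  {cfg | ∃ t' : Fin n, Early m n x i t' ∧
    (i, t') ∈ (proc m n x cfg t.1).1 ∪ (proc m n x cfg t.1).2}

/-- `O^L_{i,t}`: the event that bin `i` is matched along a late edge before time `t`. -/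
def OL (x : Fin m → Fin n → ℝ) (i : Fin m) (t : Fin n) : Set (Cfg m n) :=
  {cfg | ∃ t' : Fin n, Late m n x i t' ∧
    (i, t') ∈ (proc m n x cfg t.1).1 ∪ (proc m n x cfg t.1).2}

/-- `U₁(t)`: the event that ball `t` is not matched in the first-pick step at time `t`. -/
def U1 (x : Fin m → Fin n → ℝ) (t : Fin n) : Set (Cfg m n) :=
  {cfg | ∀ i, (i, t) ∉ (proc m n x cfg (t.1 + 1)).1}

/-- The event that ball `t` arrives (`A_t = 1`). -/
def EvA (t : Fin n) : Set (Cfg m n) := {cfg | cfg.1 t = true}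

/-- The event that the first pick of ball `t` is bin `j` (`I¹_t = j`). -/
def EvI1 (j : Fin m) (t : Fin n) : Set (Cfg m n) := {cfg | cfg.2.1 t = j}


/-- The randomness used by a single ball: arrival, first pick, second pick, and coins. -/
abbrev Slot (m : ℕ) := Bool × Fin m × Fin m × (Fin m → Bool)

/-- A configuration is a choice of a slot for every ball. -/
def slots : Cfg m n ≃ (Fin n → Slot m) where
  toFun cfg t := (cfg.1 t, cfg.2.1 t, cfg.2.2.1 t, fun i => cfg.2.2.2 i t)
  invFun f := (fun t => (f t).1, fun t => (f t).2.1, fun t => (f t).2.2.1,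
    fun i t => (f t).2.2.2 i)
  left_inv _ := rfl
  right_inv _ := rfl

/-- The probability of a slot of ball `t`. -/
def slotWeight (p : Fin n → ℝ) (x : Fin m → Fin n → ℝ) (t : Fin n) (s : Slot m) : ℝ :=
  (if s.1 then p t else 1 - p t) * (x s.2.1 t / p t) * (x s.2.2.1 t / p t) *
    ∏ i, if s.2.2.2 i then q m n x i t else 1 - q m n x i t

/-- Probability of an event depending only on the randomness of ball `t`. -/
def slotPr (p : Fin n → ℝ) (x : Fin m → Fin n → ℝ) (t : Fin n) (φ : Slot m → Prop) : ℝ :=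
  ∑ s, if φ s then slotWeight m n p x t s else 0

variable {m n} {p : Fin n → ℝ} {x : Fin m → Fin n → ℝ}

lemma weight_eq_prod_slotWeight (cfg : Cfg m n) :
    weight m n p x cfg = ∏ t, slotWeight m n p x t (slots m n cfg t) := by
  simp only [weight, slotWeight, slots, Equiv.coe_fn_mk, Finset.prod_mul_distrib]
  congr 1
  exact Finset.prod_comm

/-- Events that constrain the slots of different balls separately have product probability. -/
lemma Pr_forall (φ : Fin n → Slot m → Prop) :
    Pr m n p x {cfg | ∀ t, φ t (slots m n cfg t)} = ∏ t, slotPr m n p x t (φ t) := by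
  simp only [slotPr, Pr]
  rw [Finset.prod_univ_sum, Fintype.piFinset_univ]
  refine Fintype.sum_equiv (slots m n) _ _ fun cfg => ?_
  rw [Finset.prod_ite_zero, weight_eq_prod_slotWeight]
  simp

lemma S_le_one (hx : LPFeasible m n p x) (i : Fin m) (t : Fin n) : S m n x i t ≤ 1 :=
  (Finset.sum_le_sum_of_subset_of_nonneg (Finset.filter_subset _ _)
    fun t' _ _ => hx.2.1 i t').trans (hx.2.2.1 i)

lemma q_nonneg (hx : LPFeasible m n p x) (i : Fin m) (t : Fin n) : 0 ≤ q m n x i t := by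
  have := S_le_one hx i t
  refine le_min zero_le_one (div_nonneg ?_ ?_) <;> norm_num [c]
  linarith

lemma q_le_one (i : Fin m) (t : Fin n) : q m n x i t ≤ 1 := min_le_left _ _

lemma slotWeight_nonneg (hx : LPFeasible m n p x) (t : Fin n) (s : Slot m) :
    0 ≤ slotWeight m n p x t s := by
  have hp := hx.1 t
  refine mul_nonneg (mul_nonneg (mul_nonneg ?_ ?_) ?_) (Finset.prod_nonneg fun i _ => ?_)
  · split_ifs <;> linarith
  · exact div_nonneg (hx.2.1 _ _) hp.1.le
  · exact div_nonneg (hx.2.1 _ _) hp.1.le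
  · have := q_nonneg hx i t
    have := q_le_one (x := x) i t
    split_ifs <;> linarith

lemma sum_pick (hx : LPFeasible m n p x) (t : Fin n) : ∑ i, x i t / p t = 1 := by
  rw [← Finset.sum_div, hx.2.2.2.1 t, div_self (hx.1 t).1.ne']

lemma sum_coins (t : Fin n) :
    ∑ y : Fin m → Bool, ∏ i, (if y i then q m n x i t else 1 - q m n x i t) = 1 := by
  have := Finset.prod_univ_sum (fun _ : Fin m => (Finset.univ : Finset Bool))
    (fun i b => if b then q m n x i t else 1 - q m n x i t)
  rw [Fintype.piFinset_univ] at this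
  rw [← this]
  simp

lemma sum_slot_mul (f : Bool → ℝ) (g h : Fin m → ℝ) (k : (Fin m → Bool) → ℝ) :
    ∑ s : Slot m, f s.1 * g s.2.1 * h s.2.2.1 * k s.2.2.2 =
      (∑ a, f a) * (∑ a, g a) * (∑ a, h a) * ∑ a, k a := by
  simp_rw [Fintype.sum_prod_type, ← Finset.mul_sum, ← Finset.sum_mul, ← Finset.mul_sum,
    ← Finset.sum_mul]
  rw [Finset.sum_mul_sum Finset.univ Finset.univ f g]

lemma slotPr_true (hx : LPFeasible m n p x) (t : Fin n) :
    slotPr m n p x t (fun _ => True) = 1 := by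
  simp only [slotPr, slotWeight, if_true]
  rw [sum_slot_mul (fun a => if a then p t else 1 - p t) (fun a => x a t / p t)
    (fun a => x a t / p t)
    fun y => ∏ i, if y i then q m n x i t else 1 - q m n x i t, sum_coins, sum_pick hx]
  simp

lemma slotPr_second_pick (hx : LPFeasible m n p x) (t : Fin n) (i : Fin m) :
    slotPr m n p x t (fun s => s.1 = true ∧ s.2.2.1 = i) = x i t := by
  have key : slotPr m n p x t (fun s => s.1 = true ∧ s.2.2.1 = i) = ∑ s : Slot m,
      (if s.1 = true then p t else 0) * (x s.2.1 t / p t) *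
        (if s.2.2.1 = i then x s.2.2.1 t / p t else 0) *
        ∏ i, if s.2.2.2 i then q m n x i t else 1 - q m n x i t := by
    refine Finset.sum_congr rfl fun s _ => ?_
    by_cases h₁ : s.1 = true <;> by_cases h₂ : s.2.2.1 = i <;> simp [slotWeight, h₁, h₂]
  rw [key, sum_slot_mul (fun a => if a = true then p t else 0) (fun a => x a t / p t)
    (fun a => if a = i then x a t / p t else 0)
    fun y => ∏ i, if y i then q m n x i t else 1 - q m n x i t, sum_coins, sum_pick hx]
  have := (hx.1 t).1.ne'
  simp [mul_div_cancel₀, this]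

lemma slotPr_nonneg (hx : LPFeasible m n p x) (t : Fin n) (φ : Slot m → Prop) :
    0 ≤ slotPr m n p x t φ :=
  Finset.sum_nonneg fun s _ => by
    split_ifs
    exacts [slotWeight_nonneg hx t s, le_rfl]

lemma slotPr_not (hx : LPFeasible m n p x) (t : Fin n) (φ : Slot m → Prop) :
    slotPr m n p x t (fun s => ¬ φ s) = 1 - slotPr m n p x t φ := by
  rw [← slotPr_true hx t, slotPr, slotPr, slotPr, ← Finset.sum_sub_distrib]
  refine Finset.sum_congr rfl fun s _ => ?_
  by_cases h : φ s <;> simp [h]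

lemma slotPr_or_of_disjoint (t : Fin n) (φ ψ : Slot m → Prop) (h : ∀ s, φ s → ¬ ψ s) :
    slotPr m n p x t (fun s => φ s ∨ ψ s) = slotPr m n p x t φ + slotPr m n p x t ψ := by
  rw [slotPr, slotPr, slotPr, ← Finset.sum_add_distrib]
  refine Finset.sum_congr rfl fun s _ => ?_
  by_cases h₁ : φ s
  · simp [h₁, h s h₁]
  · simp [h₁]

/-- Disjoint events in one slot have negatively correlated complements. -/
lemma slotPr_not_and_not_le (hx : LPFeasible m n p x) (t : Fin n) (φ ψ : Slot m → Prop)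
    (h : ∀ s, φ s → ¬ ψ s) :
    slotPr m n p x t (fun s => ¬ φ s ∧ ¬ ψ s) ≤
      slotPr m n p x t (fun s => ¬ φ s) * slotPr m n p x t (fun s => ¬ ψ s) := by
  have := slotPr_not hx t fun s => φ s ∨ ψ s
  simp only [not_or] at this
  rw [this, slotPr_or_of_disjoint t φ ψ h, slotPr_not hx, slotPr_not hx]
  nlinarith [mul_nonneg (slotPr_nonneg hx t φ) (slotPr_nonneg hx t ψ)]

lemma weight_nonneg (hx : LPFeasible m n p x) (cfg : Cfg m n) : 0 ≤ weight m n p x cfg := by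
  rw [weight_eq_prod_slotWeight]
  exact Finset.prod_nonneg fun t _ => slotWeight_nonneg hx t _

lemma Pr_nonneg (hx : LPFeasible m n p x) (E : Set (Cfg m n)) : 0 ≤ Pr m n p x E :=
  Finset.sum_nonneg fun cfg _ => by
    split_ifs
    exacts [weight_nonneg hx cfg, le_rfl]

lemma Pr_mono (hx : LPFeasible m n p x) {E F : Set (Cfg m n)} (h : E ⊆ F) :
    Pr m n p x E ≤ Pr m n p x F := by
  refine Finset.sum_le_sum fun cfg _ => ?_
  have := weight_nonneg hx cfg
  by_cases hE : cfg ∈ E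
  · simp [hE, h hE]
  · rw [if_neg hE]
    split_ifs
    exacts [this, le_rfl]

lemma Pr_union_le (hx : LPFeasible m n p x) (E F : Set (Cfg m n)) :
    Pr m n p x (E ∪ F) ≤ Pr m n p x E + Pr m n p x F := by
  rw [Pr, Pr, Pr, ← Finset.sum_add_distrib]
  refine Finset.sum_le_sum fun cfg _ => ?_
  have := weight_nonneg hx cfg
  by_cases hE : cfg ∈ E <;> by_cases hF : cfg ∈ F <;> simp [hE, hF, this]

lemma Pr_empty : Pr m n p x ∅ = 0 := by simp [Pr]

lemma Pr_biUnion_le (hx : LPFeasible m n p x) {ι : Type*} (s : Finset ι)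
    (E : ι → Set (Cfg m n)) :
    Pr m n p x (⋃ k ∈ s, E k) ≤ ∑ k ∈ s, Pr m n p x (E k) := by
  induction s using Finset.induction_on with
  | empty => simp [Pr_empty]
  | insert k s hk ih =>
    rw [Finset.set_biUnion_insert, Finset.sum_insert hk]
    exact (Pr_union_le hx _ _).trans (by linarith)

lemma Pr_slot (hx : LPFeasible m n p x) (t : Fin n) (φ : Slot m → Prop) :
    Pr m n p x {cfg | φ (slots m n cfg t)} = slotPr m n p x t φ := by
  have h := Pr_forall (p := p) (x := x) fun t' s => t' = t → φ s
  simp only [forall_eq] at h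
  rw [h, Finset.prod_eq_single t]
  · simp
  · intro t' _ ht'
    simp [ht', slotPr_true hx]
  · simp

lemma Pr_univ (hx : LPFeasible m n p x) : Pr m n p x Set.univ = 1 := by
  have h := Pr_forall (p := p) (x := x) fun (_ : Fin n) (_ : Slot m) => True
  simpa [slotPr_true hx] using h

lemma Pr_le_one (hx : LPFeasible m n p x) (E : Set (Cfg m n)) : Pr m n p x E ≤ 1 :=
  (Pr_mono hx (Set.subset_univ E)).trans (Pr_univ hx).le

/-- The first pick of the ball is bin `i`, and both the ball and the coin of `i` agree. -/
def FirstProposal (i : Fin m) (s : Slot m) : Prop :=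
  s.1 = true ∧ s.2.1 = i ∧ s.2.2.2 i = true

/-- The event that bin `i` receives no accepted first pick before time `t`. -/
def NoProposal (i : Fin m) (t : Fin n) : Set (Cfg m n) :=
  {cfg | ∀ t' < t, ¬ FirstProposal i (slots m n cfg t')}

lemma Pr_NoProposal_inter_le (hx : LPFeasible m n p x) (t : Fin n) {i j : Fin m} (hij : i ≠ j) :
    Pr m n p x (NoProposal i t ∩ NoProposal j t) ≤
      Pr m n p x (NoProposal i t) * Pr m n p x (NoProposal j t) := by
  have hinter : (NoProposal i t ∩ NoProposal j t : Set (Cfg m n)) =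
      {cfg | ∀ t' < t, ¬ FirstProposal i (slots m n cfg t') ∧
        ¬ FirstProposal j (slots m n cfg t')} := by
    ext cfg
    simp only [NoProposal, Set.mem_inter_iff, Set.mem_ofPred_eq]
    exact ⟨fun h t' ht' => ⟨h.1 t' ht', h.2 t' ht'⟩,
      fun h => ⟨fun t' ht' => (h t' ht').1, fun t' ht' => (h t' ht').2⟩⟩
  have hsingle (k : Fin m) : Pr m n p x (NoProposal k t) =
      ∏ t', slotPr m n p x t' fun s => t' < t → ¬ FirstProposal k s :=
    Pr_forall fun t' s => t' < t → ¬ FirstProposal k s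
  rw [hinter, Pr_forall fun t' s => t' < t → ¬ FirstProposal i s ∧ ¬ FirstProposal j s, hsingle, hsingle, ← Finset.prod_mul_distrib]
  refine Finset.prod_le_prod (fun t' _ => slotPr_nonneg hx _ _) fun t' _ => ?_
  by_cases ht' : t' < t
  · simp only [ht', true_imp_iff]
    exact slotPr_not_and_not_le hx t' _ _ fun s h₁ h₂ => hij (h₁.2.1.symm.trans h₂.2.1)
  · simp [ht', slotPr_true hx]

lemma FreeBin.mono {M N : Finset (Fin m × Fin n)} (h : M ⊆ N) {i : Fin m}
    (hN : FreeBin m n N i) : FreeBin m n M i :=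
  fun t ht => hN t (h ht)

/-- The set of edges matched before time `t`. -/
def matched (x : Fin m → Fin n → ℝ) (cfg : Cfg m n) (t : ℕ) : Finset (Fin m × Fin n) :=
  (proc m n x cfg t).1 ∪ (proc m n x cfg t).2

lemma matched_succ (cfg : Cfg m n) (t : Fin n) :
    matched x cfg (t + 1) =
      if cfg.1 t = true ∧ FreeBin m n (matched x cfg t) (cfg.2.1 t) ∧
          cfg.2.2.2 (cfg.2.1 t) t = true then
        insert (cfg.2.1 t, t) (matched x cfg t)
      else if cfg.1 t = true ∧ FreeBin m n (matched x cfg t) (cfg.2.2.1 t) ∧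
          Late m n x (cfg.2.2.1 t) t then
        insert (cfg.2.2.1 t, t) (matched x cfg t)
      else matched x cfg t := by
  have h : proc m n x cfg (t + 1) =
      if cfg.1 t = true ∧ FreeBin m n (matched x cfg t) (cfg.2.1 t) ∧
          cfg.2.2.2 (cfg.2.1 t) t = true then
        (insert (cfg.2.1 t, t) (proc m n x cfg t).1, (proc m n x cfg t).2)
      else if cfg.1 t = true ∧ FreeBin m n (matched x cfg t) (cfg.2.2.1 t) ∧
          Late m n x (cfg.2.2.1 t) t then
        ((proc m n x cfg t).1, insert (cfg.2.2.1 t, t) (proc m n x cfg t).2)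
      else proc m n x cfg t :=
    dif_pos t.isLt
  rw [matched, h]
  split_ifs <;> simp [matched]

lemma not_firstProposal_of_freeBin (cfg : Cfg m n) (i : Fin m) (k : ℕ)
    (hfree : FreeBin m n (matched x cfg k) i) (t : Fin n) (ht : t.1 < k) :
    ¬ FirstProposal i (slots m n cfg t) := by
  induction k with
  | zero => omega
  | succ k ih =>
    by_cases hk : k < n
    · have hs := matched_succ (x := x) cfg ⟨k, hk⟩
      simp only at hs
      have hsub : matched x cfg k ⊆ matched x cfg (k + 1) := by
        rw [hs]
        split_ifs <;> simp
      rcases Nat.lt_succ_iff_lt_or_eq.mp ht with h | h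
      · exact ih (hfree.mono hsub) h
      · obtain rfl : t = ⟨k, hk⟩ := Fin.ext h
        rintro ⟨hA, hI, hY⟩
        simp only [slots, Equiv.coe_fn_mk] at hA hI hY
        rw [if_pos ⟨hA, hI ▸ hfree.mono hsub, hI ▸ hY⟩] at hs
        refine hfree ⟨k, hk⟩ ?_
        rw [hs, hI]
        exact Finset.mem_insert_self _ _
    · have := t.isLt
      have h : matched x cfg (k + 1) = matched x cfg k := by simp [matched, proc, hk]
      exact ih (h ▸ hfree) (by omega)

lemma freeBin_of_not_proposals (cfg : Cfg m n) (i : Fin m) (k : ℕ) (hk : k ≤ n)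
    (h₁ : ∀ t : Fin n, t.1 < k → ¬ FirstProposal i (slots m n cfg t))
    (h₂ : ∀ t : Fin n, t.1 < k → Late m n x i t → ¬ (cfg.1 t = true ∧ cfg.2.2.1 t = i)) :
    FreeBin m n (matched x cfg k) i := by
  induction k with
  | zero => intro t; simp [matched, proc]
  | succ k ih =>
    have ih := ih (by omega) (fun t ht => h₁ t (by omega)) fun t ht => h₂ t (by omega)
    have h₁ := h₁ ⟨k, hk⟩ (by simp)
    have h₂ := h₂ ⟨k, hk⟩ (by simp)
    have hs := matched_succ (x := x) cfg ⟨k, hk⟩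
    simp only at hs
    rw [hs]
    intro t
    split_ifs with hf hl
    · rw [Finset.mem_insert, Prod.ext_iff]
      rintro (⟨h, -⟩ | h)
      · simp only at h
        exact h₁ ⟨hf.1, h.symm, by simpa [slots, h] using hf.2.2⟩
      · exact ih t h
    · rw [Finset.mem_insert, Prod.ext_iff]
      rintro (⟨h, -⟩ | h)
      · simp only at h
        exact h₂ (h ▸ hl.2.2) ⟨hl.1, h.symm⟩
      · exact ih t h
    · exact ih t

lemma V_subset_NoProposal (i : Fin m) (t : Fin n) : V m n x i t ⊆ NoProposal i t :=
  fun cfg hcfg => not_firstProposal_of_freeBin cfg i t.1 hcfg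

/-- The late part of the fractional solution at a bin is small. -/
lemma sum_late_le (hx : LPFeasible m n p x) (i : Fin m) :
    ∑ t ∈ Finset.univ.filter (fun t => Late m n x i t), x i t ≤ 2 * c / (1 / 2 + c) := by
  rcases (Finset.univ.filter fun t => Late m n x i t).eq_empty_or_nonempty with h | h
  · rw [h]
    norm_num [c]
  · obtain ⟨t₀, ht₀, hmin⟩ := Finset.exists_min_image _ id h
    have hlate : (1 / 2 - c) / (1 / 2 + c) < S m n x i t₀ :=
      not_le.mp (Finset.mem_filter.mp ht₀).2
    have hsplit := Finset.sum_filter_add_sum_filter_not Finset.univ (fun t => t < t₀) (x i)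
    have hle : ∑ t ∈ Finset.univ.filter (fun t => Late m n x i t), x i t ≤
        ∑ t ∈ Finset.univ.filter (fun t => ¬ t < t₀), x i t :=
      Finset.sum_le_sum_of_subset_of_nonneg
        (fun t ht => Finset.mem_filter.mpr ⟨Finset.mem_univ t, not_lt.mpr (hmin t ht)⟩)
        fun t _ _ => hx.2.1 i t
    have hone := hx.2.2.1 i
    have hc : 2 * c / (1 / 2 + c) = 1 - (1 / 2 - c) / (1 / 2 + c) := by norm_num [c]
    rw [S] at hlate
    linarith

lemma Pr_NoProposal_le (hx : LPFeasible m n p x) (i : Fin m) (t : Fin n) :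
    Pr m n p x (NoProposal i t) ≤ Pr m n p x (V m n x i t) + 2 * c / (1 / 2 + c) := by
  have hsub : NoProposal i t ⊆ V m n x i t ∪
      ⋃ t' ∈ Finset.univ.filter (fun t' => Late m n x i t'),
        {cfg : Cfg m n | (fun s : Slot m => s.1 = true ∧ s.2.2.1 = i) (slots m n cfg t')} := by
    intro cfg hcfg
    by_contra hcon
    simp only [Set.mem_union, Set.mem_iUnion, not_or, not_exists] at hcon
    exact hcon.1 (freeBin_of_not_proposals cfg i t.1 t.isLt.le hcfg fun t' _ hl h =>
      hcon.2 t' (Finset.mem_filter.mpr ⟨Finset.mem_univ _, hl⟩) h)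
  refine (Pr_mono hx hsub).trans ((Pr_union_le hx _ _).trans ?_)
  have h := Pr_biUnion_le hx (Finset.univ.filter fun t' => Late m n x i t') fun t' =>
    {cfg : Cfg m n | (fun s : Slot m => s.1 = true ∧ s.2.2.1 = i) (slots m n cfg t')}
  simp only [Pr_slot hx _ (fun s : Slot m => s.1 = true ∧ s.2.2.1 = i),
    slotPr_second_pick hx] at h
  have := sum_late_le hx i
  linarith

variable (m n)

/-- in the rounding process with LP-feasible `x`, for every time `t` and
bins `i ≠ j`, the indicators of `V_{i,t}` and `V_{j,t}` satisfy
`Cov(1_{V_{i,t}}, 1_{V_{j,t}}) = P[V_{i,t} ∩ V_{j,t}] − P[V_{i,t}]·P[V_{j,t}] ≤ 12c`. -/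
theorem vacancy_low_correlation (p : Fin n → ℝ) (x : Fin m → Fin n → ℝ)
    (hx : LPFeasible m n p x) (t : Fin n) (i j : Fin m) (hij : i ≠ j) :
    Pr m n p x (V m n x i t ∩ V m n x j t) -
      Pr m n p x (V m n x i t) * Pr m n p x (V m n x j t) ≤ 12 * c := by
  have hinter := (Pr_mono hx (Set.inter_subset_inter (V_subset_NoProposal (x := x) i t)
    (V_subset_NoProposal (x := x) j t))).trans (Pr_NoProposal_inter_le hx t hij)
  have hi := Pr_NoProposal_le hx i t
  have hj := Pr_NoProposal_le hx j t
  have hi₀ := Pr_nonneg hx (V m n x i t)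
  have hi₁ := Pr_le_one hx (V m n x i t)
  have hj₀ := Pr_nonneg hx (NoProposal (m := m) j t)
  have hj₁ := Pr_le_one hx (NoProposal (m := m) j t)
  have hb : 2 * c / (1 / 2 + c) = 2 / 51 := by norm_num [c]
  rw [hb] at hi hj
  have hc : 12 * c = 3 / 25 := by norm_num [c]
  rw [hc]
  nlinarith [mul_le_mul_of_nonneg_right hi hj₀, mul_le_mul_of_nonneg_left hj hi₀]

end Rounding
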